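/- arXiv:1702.08575 — 7 statements merged into one kernel-verified Lean document; each statement's English description precedes it below -/
import Mathlib

section
/- Let A11 be an n×n, A12 an n×m, A21 an m×n, and A22 an m×m real matrix with A22^l = 0 for some l ≥ 1, and let x : ℕ → ℝ^n, z : ℕ → ℝ^m, ωX : ℕ → ℝ^n, ωZ : ℕ → ℝ^m be sequences satisfying, for all t ≥ 0, x(t+1) = A11·x(t) + A12·z(t) + ωX(t+1) and z(t+1) = A21·x(t) + A22·z(t) + ωZ(t+1). Then for every t ≥ l, x(t+1) = Σ_{k=0}^{l} A*_k·x(t−k) + Σ_{k=0}^{l−1} A12·A22^k·ωZ(t−k) + ωX(t+1), where A*_0 := A11 and A*_k := A12·A22^{k−1}·A21 for k ≥ 1. -/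
/-- Unrolling `j` steps of an affine linear recursion. -/
theorem Matrix.affine_recursion_unroll {ι R : Type*} [Fintype ι] [DecidableEq ι] [CommSemiring R]
    (M : Matrix ι ι R) (u f : ℕ → ι → R) (hu : ∀ t, u (t + 1) = M.mulVec (u t) + f (t + 1))
    {j t : ℕ} (hjt : j ≤ t) :
    u t = (M ^ j).mulVec (u (t - j)) + ∑ k ∈ Finset.range j, (M ^ k).mulVec (f (t - k)) := by
  induction j with
  | zero => simp
  | succ j ih =>
    have hstep := hu (t - (j + 1))
    rw [show t - (j + 1) + 1 = t - j by lia] at hstep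
    rw [ih (by lia), Finset.sum_range_succ, hstep, Matrix.mulVec_add, Matrix.mulVec_mulVec,
      ← pow_succ]
    abel

/-- Truncated representation (Equation (3)) of the first-order VAR recursion
under the nilpotency condition `A22 ^ l = 0` (Assumption 1: the latent transition matrix is
acyclic). -/
theorem var_truncated {n m : ℕ}
    (A11 : Matrix (Fin n) (Fin n) ℝ) (A12 : Matrix (Fin n) (Fin m) ℝ)
    (A21 : Matrix (Fin m) (Fin n) ℝ) (A22 : Matrix (Fin m) (Fin m) ℝ)
    (l : ℕ) (hl1 : 1 ≤ l) (hnil : A22 ^ l = 0)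
    (x : ℕ → Fin n → ℝ) (z : ℕ → Fin m → ℝ)
    (ωX : ℕ → Fin n → ℝ) (ωZ : ℕ → Fin m → ℝ)
    (hx : ∀ t, x (t + 1) = A11.mulVec (x t) + A12.mulVec (z t) + ωX (t + 1))
    (hz : ∀ t, z (t + 1) = A21.mulVec (x t) + A22.mulVec (z t) + ωZ (t + 1))
    (Astar : ℕ → Matrix (Fin n) (Fin n) ℝ)
    (hA0 : Astar 0 = A11)
    (hAk : ∀ k, 1 ≤ k → Astar k = A12 * A22 ^ (k - 1) * A21) :
    ∀ t, l ≤ t → x (t + 1) =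
      (∑ k ∈ Finset.range (l + 1), (Astar k).mulVec (x (t - k))) +
      (∑ k ∈ Finset.range l, (A12 * A22 ^ k).mulVec (ωZ (t - k))) +
      ωX (t + 1) := by
  intro t ht
  have hz' := Matrix.affine_recursion_unroll A22 z
    (fun t => A21.mulVec (x (t - 1)) + ωZ t)
    (fun t => by rw [hz, Nat.add_sub_cancel]; abel) ht
  rw [hnil, Matrix.zero_mulVec, zero_add] at hz'
  have hsum : A12.mulVec (z t) =
      (∑ k ∈ Finset.range l, (Astar (k + 1)).mulVec (x (t - (k + 1)))) +
      ∑ k ∈ Finset.range l, (A12 * A22 ^ k).mulVec (ωZ (t - k)) := by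
    rw [hz', Matrix.mulVec_sum, ← Finset.sum_add_distrib]
    refine Finset.sum_congr rfl fun k _ => ?_
    rw [hAk (k + 1) (Nat.le_add_left 1 k), Nat.add_sub_cancel, Matrix.mulVec_mulVec,
      Matrix.mulVec_add, Matrix.mulVec_mulVec, Nat.sub_sub]
  rw [hx, hsum, Finset.sum_range_succ', hA0, Nat.sub_zero]
  abel
end

section
/- Let A be an m×q real matrix, C an m×n real matrix, Γ a q×q real symmetric positive semidefinite matrix, and Σ an n×n real symmetric positive semidefinite matrix, and suppose A·Γ·Aᵀ − C·Σ·Cᵀ is positive semidefinite. Then λ_min(Σ)·‖C‖₂² ≤ λ_max(Γ)·‖A‖₂². -/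
open Matrix

/-- The spectral norm (operator norm induced by the Euclidean norm) of a real matrix. -/
noncomputable def specNorm {α β : Type*} [Fintype α] [Fintype β] [DecidableEq β]
    (A : Matrix α β ℝ) : ℝ :=
  ‖LinearMap.toContinuousLinearMap (Matrix.toEuclideanLin A)‖

/-- The smallest eigenvalue of a real symmetric matrix. -/
noncomputable def lamMin {n : ℕ} {S : Matrix (Fin n) (Fin n) ℝ} (hS : S.IsHermitian) : ℝ :=
  ⨅ i, hS.eigenvalues i

/-- The largest eigenvalue of a real symmetric matrix. -/
noncomputable def lamMax {n : ℕ} {S : Matrix (Fin n) (Fin n) ℝ} (hS : S.IsHermitian) : ℝ :=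
  ⨆ i, hS.eigenvalues i

open scoped Matrix.Norms.L2Operator in
theorem specNorm_transpose {α β : Type*} [Fintype α] [Fintype β] [DecidableEq α] [DecidableEq β]
    (A : Matrix α β ℝ) : specNorm Aᵀ = specNorm A := by
  have h := Matrix.l2_opNorm_conjTranspose A
  rwa [conjTranspose_eq_transpose_of_trivial] at h

theorem specNorm_nonneg {α β : Type*} [Fintype α] [Fintype β] [DecidableEq β]
    (A : Matrix α β ℝ) : 0 ≤ specNorm A :=
  norm_nonneg _

theorem norm_toEuclideanLin_le_specNorm {α β : Type*} [Fintype α] [Fintype β] [DecidableEq β]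
    (A : Matrix α β ℝ) (x : EuclideanSpace ℝ β) :
    ‖toEuclideanLin A x‖ ≤ specNorm A * ‖x‖ :=
  (LinearMap.toContinuousLinearMap (toEuclideanLin A)).le_opNorm x

theorem inner_toEuclideanLin_eq_dotProduct {β : Type*} [Fintype β] [DecidableEq β]
    (S : Matrix β β ℝ) (x : EuclideanSpace ℝ β) :
    inner ℝ x (toEuclideanLin S x) = x.ofLp ⬝ᵥ S *ᵥ x.ofLp := by
  simp [EuclideanSpace.inner_eq_star_dotProduct, dotProduct_comm]

/-- The quadratic form of a symmetric matrix in coordinates along its eigenvectors. -/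
theorem inner_toEuclideanLin_eq_sum_eigenvalues {β : Type*} [Fintype β] [DecidableEq β]
    {S : Matrix β β ℝ} (hS : S.IsHermitian) (x : EuclideanSpace ℝ β) :
    inner ℝ x (toEuclideanLin S x) =
      ∑ i, hS.eigenvalues i * ‖inner ℝ (hS.eigenvectorBasis i) x‖ ^ 2 := by
  rw [← hS.eigenvectorBasis.sum_inner_mul_inner]
  refine Finset.sum_congr rfl fun i _ => ?_
  have hb : toEuclideanLin S (hS.eigenvectorBasis i) =
      hS.eigenvalues i • hS.eigenvectorBasis i := by
    ext1
    exact congrFun (hS.mulVec_eigenvectorBasis i) _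
  rw [← (isSymmetric_toEuclideanLin_iff.mpr hS) (hS.eigenvectorBasis i) x, hb,
    real_inner_smul_left, real_inner_comm, Real.norm_eq_abs, sq_abs]
  ring

theorem lamMin_mul_norm_sq_le_inner {n : ℕ} {S : Matrix (Fin n) (Fin n) ℝ} (hS : S.IsHermitian)
    (x : EuclideanSpace ℝ (Fin n)) :
    lamMin hS * ‖x‖ ^ 2 ≤ inner ℝ x (toEuclideanLin S x) := by
  rw [inner_toEuclideanLin_eq_sum_eigenvalues hS, ← hS.eigenvectorBasis.sum_sq_norm_inner_right x,
    Finset.mul_sum]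
  gcongr with i
  exact ciInf_le (Set.finite_range _).bddBelow i

theorem inner_le_lamMax_mul_norm_sq {n : ℕ} {S : Matrix (Fin n) (Fin n) ℝ} (hS : S.IsHermitian)
    (x : EuclideanSpace ℝ (Fin n)) :
    inner ℝ x (toEuclideanLin S x) ≤ lamMax hS * ‖x‖ ^ 2 := by
  rw [inner_toEuclideanLin_eq_sum_eigenvalues hS, ← hS.eigenvectorBasis.sum_sq_norm_inner_right x,
    Finset.mul_sum]
  gcongr with i
  exact le_ciSup (Set.finite_range _).bddAbove i

theorem inner_toEuclideanLin_mul_mul_transpose {α β : Type*} [Fintype α] [Fintype β]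
    [DecidableEq α] [DecidableEq β] (A : Matrix α β ℝ) (S : Matrix β β ℝ)
    (x : EuclideanSpace ℝ α) :
    inner ℝ (toEuclideanLin Aᵀ x) (toEuclideanLin S (toEuclideanLin Aᵀ x)) =
      x.ofLp ⬝ᵥ (A * S * Aᵀ) *ᵥ x.ofLp := by
  rw [inner_toEuclideanLin_eq_dotProduct]
  simp [← mulVec_mulVec, dotProduct_mulVec, vecMul_vecMul, mulVec_transpose]

theorem mul_specNorm_sq_le {α β : Type*} [Fintype α] [Fintype β] [DecidableEq β]
    (A : Matrix α β ℝ) {c K : ℝ} (hc : 0 ≤ c) (hK : 0 ≤ K)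
    (h : ∀ x, c * ‖toEuclideanLin A x‖ ^ 2 ≤ K * ‖x‖ ^ 2) :
    c * specNorm A ^ 2 ≤ K := by
  have hle : √c * specNorm A ≤ √K := by
    have hs : √c * specNorm A =
        ‖√c • LinearMap.toContinuousLinearMap (toEuclideanLin A)‖ := by
      rw [norm_smul, Real.norm_of_nonneg (Real.sqrt_nonneg c), specNorm]
    rw [hs]
    refine ContinuousLinearMap.opNorm_le_bound _ (Real.sqrt_nonneg K) fun x => ?_
    rw [_root_.smul_apply, norm_smul, Real.norm_of_nonneg (Real.sqrt_nonneg c)]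
    refine le_of_sq_le_sq ?_ (by positivity)
    rw [mul_pow, mul_pow, Real.sq_sqrt hc, Real.sq_sqrt hK]
    exact h x
  have hsq := pow_le_pow_left₀ (mul_nonneg (Real.sqrt_nonneg c) (specNorm_nonneg A)) hle 2
  rwa [mul_pow, Real.sq_sqrt hc, Real.sq_sqrt hK] at hsq


/-- If `A·Γ·Aᵀ - C·Σ·Cᵀ` is positive semidefinite (with `Γ`, `Σ` symmetric
positive semidefinite), then `λ_min(Σ)·‖C‖₂² ≤ λ_max(Γ)·‖A‖₂²`. -/
theorem lamMin_specNorm_le {m q n : ℕ}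
    (A : Matrix (Fin m) (Fin q) ℝ) (C : Matrix (Fin m) (Fin n) ℝ)
    (Γ : Matrix (Fin q) (Fin q) ℝ) (Sg : Matrix (Fin n) (Fin n) ℝ)
    (hΓ : Γ.PosSemidef) (hSg : Sg.PosSemidef)
    (h : (A * Γ * Aᵀ - C * Sg * Cᵀ).PosSemidef) :
    lamMin hSg.1 * specNorm C ^ 2 ≤ lamMax hΓ.1 * specNorm A ^ 2 := by
  have hmax : 0 ≤ lamMax hΓ.1 := Real.iSup_nonneg hΓ.eigenvalues_nonneg
  have hmin : 0 ≤ lamMin hSg.1 := Real.iInf_nonneg hSg.eigenvalues_nonneg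
  rw [← specNorm_transpose C, ← specNorm_transpose A]
  refine mul_specNorm_sq_le _ hmin (by positivity) fun x => ?_
  have hx := h.dotProduct_mulVec_nonneg x.ofLp
  rw [star_trivial, sub_mulVec, dotProduct_sub, sub_nonneg,
    ← inner_toEuclideanLin_mul_mul_transpose, ← inner_toEuclideanLin_mul_mul_transpose] at hx
  calc lamMin hSg.1 * ‖toEuclideanLin Cᵀ x‖ ^ 2
      ≤ inner ℝ (toEuclideanLin Cᵀ x) (toEuclideanLin Sg (toEuclideanLin Cᵀ x)) :=
        lamMin_mul_norm_sq_le_inner hSg.1 _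
    _ ≤ inner ℝ (toEuclideanLin Aᵀ x) (toEuclideanLin Γ (toEuclideanLin Aᵀ x)) := hx
    _ ≤ lamMax hΓ.1 * ‖toEuclideanLin Aᵀ x‖ ^ 2 := inner_le_lamMax_mul_norm_sq hΓ.1 _
    _ ≤ lamMax hΓ.1 * (specNorm Aᵀ * ‖x‖) ^ 2 := by
        gcongr
        exact norm_toEuclideanLin_le_specNorm _ _
    _ = lamMax hΓ.1 * specNorm Aᵀ ^ 2 * ‖x‖ ^ 2 := by ring
end

section
/- Let A12 be an n×m real matrix and A22 an m×m real matrix with ‖A22‖₂ < 1, let l ≥ 1 and 0 ≤ r ≤ l−2, and let Ã be the block-diagonal matrix diag(A12·A22^{r+1}, …, A12·A22^{l−1}) with l−r−1 diagonal blocks. Let C^0, …, C^{l−r−2} be n×n real matrices and let 𝐂 be the (n(l−r−1))×n matrix obtained by stacking them vertically. Let Γ be a symmetric positive semidefinite matrix of size m(l−r−1) with λ_max(Γ) ≤ M, and Σ an n×n symmetric positive semidefinite matrix with λ_min(Σ) ≥ L > 0. If Ã·Γ·Ãᵀ − 𝐂·Σ·𝐂ᵀ is positive semidefinite, then ‖Σ_{s=0}^{l−r−2}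 C^s‖₁ ≤ √(n(l−r−1)·M/L)·‖A12‖₂·‖A22‖₂^{r+1}. -/
open Matrix

/-- The operator norm induced by the `ℓ¹` vector norm: the maximum absolute column sum. -/
noncomputable def norm1 {α β : Type*} [Fintype α] [Fintype β] (A : Matrix α β ℝ) : ℝ :=
  ⨆ j, ∑ i, |A i j|

open scoped Matrix.Norms.L2Operator in
theorem specNorm_eq_l2_opNorm {α β : Type*} [Fintype α] [Fintype β] [DecidableEq β]
    (A : Matrix α β ℝ) : specNorm A = ‖A‖ := by
  rw [Matrix.l2_opNorm_def]
  rfl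

theorem specNorm_of_isEmpty {α β : Type*} [Fintype α] [Fintype β] [DecidableEq β] [IsEmpty β]
    (A : Matrix α β ℝ) : specNorm A = 0 := by
  have hA : A = 0 := by
    ext i j
    exact isEmptyElim j
  simp [specNorm, hA]

open scoped Matrix.Norms.L2Operator in
theorem specNorm_mul_pow_le {α β : Type*} [Fintype α] [Fintype β] [DecidableEq β]
    (A : Matrix α β ℝ) (B : Matrix β β ℝ) (hB : specNorm B ≤ 1) {p q : ℕ} (hp : 0 < p)
    (hpq : p ≤ q) : specNorm (A * B ^ q) ≤ specNorm A * specNorm B ^ p := by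
  simp only [specNorm_eq_l2_opNorm] at *
  calc ‖A * B ^ q‖ ≤ ‖A‖ * ‖B ^ q‖ := Matrix.l2_opNorm_mul _ _
    _ ≤ ‖A‖ * ‖B‖ ^ q := by gcongr; exact norm_pow_le' _ (hp.trans_le hpq)
    _ ≤ ‖A‖ * ‖B‖ ^ p := by
      gcongr ?_ * ?_
      exact pow_le_pow_of_le_one (norm_nonneg _) hB hpq

open scoped Matrix.Norms.L2Operator in
theorem sum_sq_transpose_mulVec_le {α β : Type*} [Fintype α] [Fintype β] [DecidableEq α]
    [DecidableEq β] (A : Matrix α β ℝ) (v : α → ℝ) :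
    ∑ j, (Aᵀ *ᵥ v) j ^ 2 ≤ specNorm A ^ 2 * ∑ i, v i ^ 2 := by
  have h := Matrix.l2_opNorm_mulVec Aᵀ (WithLp.toLp 2 v)
  rw [← Matrix.conjTranspose_eq_transpose_of_trivial, Matrix.l2_opNorm_conjTranspose,
    ← specNorm_eq_l2_opNorm] at h
  have h2 := pow_le_pow_left₀ (norm_nonneg _) h 2
  rw [mul_pow, EuclideanSpace.real_norm_sq_eq, EuclideanSpace.real_norm_sq_eq] at h2
  simpa using h2

open scoped MatrixOrder in
theorem Matrix.IsHermitian.dotProduct_mulVec_le {ι : Type*} [Fintype ι] [DecidableEq ι]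
    {S : Matrix ι ι ℝ} (hS : S.IsHermitian) {M : ℝ} (hM : ∀ i, hS.eigenvalues i ≤ M)
    (x : ι → ℝ) : x ⬝ᵥ S *ᵥ x ≤ M * (x ⬝ᵥ x) := by
  have h : S ≤ algebraMap ℝ _ M := by
    refine le_algebraMap_of_spectrum_le (fun t ht => ?_) hS
    rw [hS.spectrum_real_eq_range_eigenvalues] at ht
    obtain ⟨i, rfl⟩ := ht
    exact hM i
  have := (Matrix.le_iff.mp h).dotProduct_mulVec_nonneg x
  simpa [Matrix.sub_mulVec, Algebra.algebraMap_eq_smul_one, Matrix.smul_mulVec] using this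

open scoped MatrixOrder in
theorem Matrix.IsHermitian.le_dotProduct_mulVec {ι : Type*} [Fintype ι] [DecidableEq ι]
    {S : Matrix ι ι ℝ} (hS : S.IsHermitian) {L : ℝ} (hL : ∀ i, L ≤ hS.eigenvalues i)
    (x : ι → ℝ) : L * (x ⬝ᵥ x) ≤ x ⬝ᵥ S *ᵥ x := by
  have h : algebraMap ℝ _ L ≤ S := by
    refine algebraMap_le_of_le_spectrum (fun t ht => ?_) hS
    rw [hS.spectrum_real_eq_range_eigenvalues] at ht
    obtain ⟨i, rfl⟩ := ht
    exact hL i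
  have := (Matrix.le_iff.mp h).dotProduct_mulVec_nonneg x
  simpa [Matrix.sub_mulVec, Algebra.algebraMap_eq_smul_one, Matrix.smul_mulVec] using this

theorem sum_sq_blockDiagonal_transpose_mulVec_le {α β κ : Type*} [Fintype α] [Fintype β]
    [Fintype κ] [DecidableEq α] [DecidableEq β] [DecidableEq κ] (A : κ → Matrix α β ℝ) {K : ℝ}
    (hK : ∀ s, specNorm (A s) ≤ K) (v : α × κ → ℝ) :
    ∑ q, ((blockDiagonal A)ᵀ *ᵥ v) q ^ 2 ≤ K ^ 2 * ∑ p, v p ^ 2 := by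
  have key (b : β) (s : κ) :
      ((blockDiagonal A)ᵀ *ᵥ v) (b, s) = ((A s)ᵀ *ᵥ fun a => v (a, s)) b := by
    simp [mulVec, dotProduct, Fintype.sum_prod_type, blockDiagonal_apply]
  simp only [Fintype.sum_prod_type_right, key, Finset.mul_sum _ _ (K ^ 2)]
  refine Finset.sum_le_sum fun s _ => (sum_sq_transpose_mulVec_le _ _).trans ?_
  rw [← Finset.mul_sum]
  gcongr
  · exact specNorm_nonneg _
  · exact hK s

theorem dotProduct_mul_mul_transpose_mulVec {ι κ : Type*} [Fintype ι] [Fintype κ]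
    (B : Matrix ι κ ℝ) (S : Matrix κ κ ℝ) (v : ι → ℝ) :
    v ⬝ᵥ (B * S * Bᵀ) *ᵥ v = (Bᵀ *ᵥ v) ⬝ᵥ S *ᵥ (Bᵀ *ᵥ v) := by
  rw [← mulVec_mulVec, ← mulVec_mulVec, dotProduct_mulVec, ← mulVec_transpose]

/-- If the quadratic form of `B * S * Bᵀ` is bounded above by `c` and that of `S` below by `L`,
then `L` times the squared Euclidean norm of each column of `B` is at most `c`. -/
theorem mul_sum_sq_col_le {ι κ : Type*} [Fintype ι] [Fintype κ] {B : Matrix ι κ ℝ}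
    {S : Matrix κ κ ℝ} {L c : ℝ} (hL : 0 ≤ L) (hc : 0 ≤ c)
    (hS : ∀ x, L * (x ⬝ᵥ x) ≤ x ⬝ᵥ S *ᵥ x)
    (hB : ∀ v, v ⬝ᵥ (B * S * Bᵀ) *ᵥ v ≤ c * ∑ p, v p ^ 2) (j : κ) :
    L * ∑ p, B p j ^ 2 ≤ c := by
  set W := ∑ p, B p j ^ 2
  have hW : 0 ≤ W := Finset.sum_nonneg fun p _ => sq_nonneg _
  set x := Bᵀ *ᵥ fun p => B p j
  have hxj : x j = W := by simp [x, W, mulVec, dotProduct, sq]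
  have hx : W ^ 2 ≤ x ⬝ᵥ x := by
    rw [← hxj, dotProduct, sq]
    exact Finset.single_le_sum (f := fun i => x i * x i) (fun i _ => mul_self_nonneg _)
      (Finset.mem_univ j)
  have h := hB fun p => B p j
  rw [dotProduct_mul_mul_transpose_mulVec] at h
  have h2 : L * W ^ 2 ≤ c * W :=
    (mul_le_mul_of_nonneg_left hx hL).trans ((hS x).trans h)
  rcases hW.eq_or_lt with h0 | h0
  · rw [← h0]; simpa using hc
  · exact le_of_mul_le_mul_right (by linarith [sq W]) h0

theorem norm1_sum_le {α β κ : Type*} [Fintype α] [Fintype β] [Fintype κ]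
    (C : κ → Matrix α β ℝ) {D : ℝ} (hC : ∀ j, ∑ p : α × κ, C p.2 p.1 j ^ 2 ≤ D) :
    norm1 (∑ s, C s) ≤ √(Fintype.card α * Fintype.card κ * D) := by
  refine Real.iSup_le (fun j => ?_) (Real.sqrt_nonneg _)
  calc ∑ i, |(∑ s, C s) i j| ≤ ∑ p : α × κ, |C p.2 p.1 j| := by
        rw [Fintype.sum_prod_type]
        refine Finset.sum_le_sum fun i _ => ?_
        rw [Matrix.sum_apply]
        exact Finset.abs_sum_le_sum_abs _ _
    _ ≤ _ := by
        refine Real.le_sqrt_of_sq_le (sq_sum_le_card_mul_sum_sq.trans ?_)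
        simp only [sq_abs, Finset.card_univ, Fintype.card_prod, Nat.cast_mul]
        gcongr
        exact hC j

/-- Deterministic content of Proposition 1 of the paper: a bound on
`‖∑ s, C^s‖₁` given that `Ã·Γ·Ãᵀ - 𝐂·Σ·𝐂ᵀ` is positive semidefinite, where `Ã` is the
block-diagonal matrix `diag(A12·A22^{r+1}, …, A12·A22^{l−1})` and `𝐂` is the vertical stacking
of `C^0, …, C^{l−r−2}`. -/
theorem prop1_bound {n m : ℕ} (l r : ℕ) (hl : 1 ≤ l) (hr : r + 2 ≤ l)
    (A12 : Matrix (Fin n) (Fin m) ℝ) (A22 : Matrix (Fin m) (Fin m) ℝ)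
    (hA22 : specNorm A22 < 1)
    (C : Fin (l - r - 1) → Matrix (Fin n) (Fin n) ℝ)
    (Γ : Matrix (Fin m × Fin (l - r - 1)) (Fin m × Fin (l - r - 1)) ℝ)
    (Sg : Matrix (Fin n) (Fin n) ℝ)
    (M L : ℝ) (hΓ : Γ.PosSemidef) (hSg : Sg.PosSemidef)
    (hM : ∀ i, hΓ.1.eigenvalues i ≤ M)
    (hL0 : 0 < L) (hL : ∀ i, L ≤ hSg.1.eigenvalues i)
    (h : (Matrix.blockDiagonal (fun s : Fin (l - r - 1) => A12 * A22 ^ (r + 1 + (s : ℕ))) * Γ *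
          (Matrix.blockDiagonal (fun s : Fin (l - r - 1) => A12 * A22 ^ (r + 1 + (s : ℕ))))ᵀ -
          (Matrix.of fun (p : Fin n × Fin (l - r - 1)) (j : Fin n) => C p.2 p.1 j) * Sg *
          (Matrix.of fun (p : Fin n × Fin (l - r - 1)) (j : Fin n) => C p.2 p.1 j)ᵀ).PosSemidef) :
    norm1 (∑ s, C s) ≤
      Real.sqrt ((n : ℝ) * ((l - r - 1 : ℕ) : ℝ) * M / L) * specNorm A12 *
        specNorm A22 ^ (r + 1) := by
  set K := specNorm A12 * specNorm A22 ^ (r + 1) with hKdef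
  have hK0 : 0 ≤ K := mul_nonneg (specNorm_nonneg _) (pow_nonneg (specNorm_nonneg _) _)
  have hMK : 0 ≤ M * K ^ 2 := by
    rcases isEmpty_or_nonempty (Fin m) with hm | ⟨⟨b⟩⟩
    · simp [hKdef, specNorm_of_isEmpty A12]
    · have hM0 : 0 ≤ M := (hΓ.eigenvalues_nonneg (b, ⟨0, by omega⟩)).trans (hM _)
      positivity
  have hA (v : Fin n × Fin (l - r - 1) → ℝ) :=
    sum_sq_blockDiagonal_transpose_mulVec_le
      (fun s : Fin (l - r - 1) => A12 * A22 ^ (r + 1 + (s : ℕ)))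
      (fun s => specNorm_mul_pow_le A12 A22 hA22.le r.succ_pos (Nat.le_add_right _ _)) v
  have hcol := mul_sum_sq_col_le hL0.le hMK (hSg.1.le_dotProduct_mulVec hL) (fun v => by
    have h1 := h.dotProduct_mulVec_nonneg v
    rw [sub_mulVec, dotProduct_sub, star_trivial, sub_nonneg,
      dotProduct_mul_mul_transpose_mulVec _ Γ] at h1
    refine h1.trans ((hΓ.1.dotProduct_mulVec_le hM _).trans ?_)
    rcases isEmpty_or_nonempty (Fin m) with hm | ⟨⟨b⟩⟩
    · simpa [dotProduct] using mul_nonneg hMK (Finset.sum_nonneg fun p _ => sq_nonneg (v p))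
    · have hM0 : 0 ≤ M := (hΓ.eigenvalues_nonneg (b, ⟨0, by omega⟩)).trans (hM _)
      rw [mul_assoc]
      refine mul_le_mul_of_nonneg_left ?_ hM0
      simpa only [dotProduct, ← sq] using hA v)
  have hfin := norm1_sum_le C (D := M * K ^ 2 / L) fun j => by
    rw [le_div_iff₀' hL0]
    exact hcol j
  refine hfin.trans_eq ?_
  rw [Fintype.card_fin, Fintype.card_fin, mul_assoc (√_), ← hKdef, ← Real.sqrt_sq hK0,
    ← Real.sqrt_mul' _ (sq_nonneg K), Real.sqrt_sq hK0]
  congr 1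
  ring
end

section
/- (Theorem 2.) Let G be a latent digraph satisfying Assumption A, and let G' be any latent digraph with the same observed node set O that is consistent with the same linear measurements as G. Then the number of latent nodes of G is at most the number of latent nodes of G'. -/
/-- A latent digraph: a directed graph on the disjoint union of a set `O` of observed nodes
and a set `H` of latent nodes, with no edges between two observed nodes. -/
structure LatentDigraph (O : Type) where
  /-- The type of latent nodes. -/
  H : Type
  /-- The edge relation on `O ⊕ H`. -/
  edge : (O ⊕ H) → (O ⊕ H) → Prop
  /-- There are no edges between two observed nodes. -/
  no_oo : ∀ i j : O, ¬ edge (Sum.inl i) (Sum.inl j)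

namespace LatentDigraph

variable {O : Type}

/-- `p` is a directed latent path of length `k` from the observed node `i` to the observed
node `j`: it has `k` edges, starts at `i`, ends at `j`, and all intermediate nodes are
latent. -/
def IsLatentPath (G : LatentDigraph O) (k : ℕ) (i j : O) (p : ℕ → O ⊕ G.H) : Prop :=
  p 0 = Sum.inl i ∧ p k = Sum.inl j ∧
    (∀ t, 0 < t → t < k → ∃ h : G.H, p t = Sum.inr h) ∧
    (∀ t, t < k → G.edge (p t) (p (t + 1)))

/-- There exists a directed latent path of length `k` from `i` to `j`. -/
def LatentPath (G : LatentDigraph O) (k : ℕ) (i j : O) : Prop :=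
  ∃ p, G.IsLatentPath k i j p

/-- Two latent digraphs on the same observed node set are consistent with the same linear
measurements: for every `k ≥ 2` they have directed latent paths of length `k` between the
same pairs of observed nodes. -/
def SameMeasurements (G G' : LatentDigraph O) : Prop :=
  ∀ k, 2 ≤ k → ∀ i j : O, G.LatentPath k i j ↔ G'.LatentPath k i j

/-- A latent leaf: a latent node with no latent children. -/
def IsLatentLeaf (G : LatentDigraph O) (h : G.H) : Prop :=
  ∀ h' : G.H, ¬ G.edge (Sum.inr h) (Sum.inr h')

/-- Assumption A of the paper: (a) the latent sub-network is a directed tree (each latent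
node has at most one latent parent and there are no directed cycles among latent nodes);
(b) every latent node has a unique observed parent; (c) every latent leaf has an observed
child that is not a child of any other latent leaf. -/
def AssumptionA (G : LatentDigraph O) : Prop :=
  (∀ h h₁ h₂ : G.H, G.edge (Sum.inr h₁) (Sum.inr h) → G.edge (Sum.inr h₂) (Sum.inr h) →
      h₁ = h₂) ∧
  (∀ (r : ℕ) (p : ℕ → G.H), 0 < r →
      (∀ t, t < r → G.edge (Sum.inr (p t)) (Sum.inr (p (t + 1)))) → p r ≠ p 0) ∧
  (∀ h : G.H, ∃ i : O, G.edge (Sum.inl i) (Sum.inr h) ∧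
      ∀ h' : G.H, h' ≠ h → ¬ G.edge (Sum.inl i) (Sum.inr h')) ∧
  (∀ h : G.H, G.IsLatentLeaf h → ∃ j : O, G.edge (Sum.inr h) (Sum.inl j) ∧
      ∀ h' : G.H, G.IsLatentLeaf h' → h' ≠ h → ¬ G.edge (Sum.inr h') (Sum.inl j))

end LatentDigraph

namespace LatentDigraph

variable {O : Type}

/-- The first `n` steps of `p` form a directed walk among latent nodes. -/
def IsLatentWalk (G : LatentDigraph O) (n : ℕ) (p : ℕ → G.H) : Prop :=
  ∀ t, t < n → G.edge (Sum.inr (p t)) (Sum.inr (p (t + 1)))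

/-- Preceding a latent walk by an observed parent of its first node and following it by an
observed child of its last node yields a directed latent path. -/
theorem IsLatentWalk.latentPath {G : LatentDigraph O} {n : ℕ} {p : ℕ → G.H}
    (hp : G.IsLatentWalk n p) {i j : O} (hi : G.edge (Sum.inl i) (Sum.inr (p 0)))
    (hj : G.edge (Sum.inr (p n)) (Sum.inl j)) : G.LatentPath (n + 2) i j := by
  refine ⟨fun t => if t = 0 then Sum.inl i else if t ≤ n + 1 then Sum.inr (p (t - 1))
    else Sum.inl j, by simp, by simp, ?_, ?_⟩
  · intro t h0 h1
    exact ⟨p (t - 1), by simp [h0.ne', Nat.le_of_lt_succ h1]⟩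
  · intro t ht
    rcases t with _ | t
    · simpa using hi
    · rcases Nat.lt_or_ge t n with h | h
      · have h1 : t + 1 ≤ n := h
        simpa [h.le, h1] using hp t h
      · obtain rfl : t = n := by omega
        simpa using hj

/-- The intermediate nodes of a directed latent path form a latent walk. -/
theorem LatentPath.exists_isLatentWalk {G : LatentDigraph O} {n : ℕ} {i j : O}
    (h : G.LatentPath (n + 2) i j) :
    ∃ p, G.IsLatentWalk n p ∧ G.edge (Sum.inl i) (Sum.inr (p 0)) ∧
      G.edge (Sum.inr (p n)) (Sum.inl j) := by
  obtain ⟨P, h0, hk, hlat, hedge⟩ := h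
  obtain ⟨h₁, -⟩ := hlat 1 one_pos (by omega)
  have hq : ∀ t, ∃ x : G.H, t ≤ n → P (t + 1) = Sum.inr x := by
    intro t
    by_cases ht : t ≤ n
    · obtain ⟨x, hx⟩ := hlat (t + 1) (by omega) (by omega)
      exact ⟨x, fun _ => hx⟩
    · exact ⟨h₁, fun h => absurd h ht⟩
  choose p hp using hq
  refine ⟨p, fun t ht => ?_, ?_, ?_⟩
  · rw [← hp t ht.le, ← hp (t + 1) ht]
    exact hedge (t + 1) (by omega)
  · rw [← h0, ← hp 0 (Nat.zero_le n)]
    exact hedge 0 (by omega)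
  · rw [← hk, ← hp n le_rfl]
    exact hedge (n + 1) (by omega)

/-- Without directed cycles among finitely many latent nodes, latent walks are short. -/
theorem IsLatentWalk.lt_card {G : LatentDigraph O} [Fintype G.H]
    (hacyc : ∀ (r : ℕ) (p : ℕ → G.H), 0 < r → G.IsLatentWalk r p → p r ≠ p 0)
    {n : ℕ} {p : ℕ → G.H} (hp : G.IsLatentWalk n p) : n < Fintype.card G.H := by
  have hinj : Function.Injective fun t : Fin (n + 1) => p t := by
    refine Function.Injective.of_lt_imp_ne fun a b hab heq => ?_
    have hlt : (a : ℕ) < b := hab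
    refine hacyc (b - a) (fun t => p (a + t)) (by omega)
      (fun t ht => hp (a + t) (by omega)) ?_
    simpa [Nat.add_sub_cancel' hlt.le] using heq.symm
  simpa using Fintype.card_le_of_injective _ hinj

/-- Every latent node is the start of a latent walk of maximal length. -/
theorem exists_longest_isLatentWalk (G : LatentDigraph O) [Fintype G.H]
    (hacyc : ∀ (r : ℕ) (p : ℕ → G.H), 0 < r → G.IsLatentWalk r p → p r ≠ p 0) (h : G.H) :
    ∃ (d : ℕ) (p : ℕ → G.H), p 0 = h ∧ G.IsLatentWalk d p ∧
      ∀ n q, q 0 = h → G.IsLatentWalk n q → n ≤ d := by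
  classical
  let S : ℕ → Prop := fun n => ∃ p : ℕ → G.H, p 0 = h ∧ G.IsLatentWalk n p
  obtain ⟨p, hp0, hp⟩ : S (Nat.findGreatest S (Fintype.card G.H)) :=
    Nat.findGreatest_spec (Nat.zero_le _) ⟨fun _ => h, rfl, fun t ht => absurd ht (by omega)⟩
  exact ⟨_, p, hp0, hp, fun n q hq0 hq =>
    Nat.le_findGreatest (hq.lt_card hacyc).le ⟨q, hq0, hq⟩⟩

/-- A latent walk of maximal length ends in a latent leaf. -/
theorem IsLatentWalk.isLatentLeaf {G : LatentDigraph O} {d : ℕ} {p : ℕ → G.H}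
    (hp : G.IsLatentWalk d p) (hmax : ∀ n q, q 0 = p 0 → G.IsLatentWalk n q → n ≤ d) :
    G.IsLatentLeaf (p d) := by
  intro h' he
  have := hmax (d + 1) (fun t => if t ≤ d then p t else h') (by simp) fun t ht => by
    rcases Nat.lt_or_ge t d with h | h
    · have h1 : t + 1 ≤ d := h
      simpa [h.le, h1] using hp t h
    · obtain rfl : t = d := by omega
      simpa using he
  omega

/-- If latent parents are unique, latent walks of equal length with the same end have the
same start. -/
theorem IsLatentWalk.start_eq {G : LatentDigraph O}
    (hpar : ∀ h h₁ h₂ : G.H, G.edge (Sum.inr h₁) (Sum.inr h) →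
      G.edge (Sum.inr h₂) (Sum.inr h) → h₁ = h₂)
    {n : ℕ} {p q : ℕ → G.H} (hp : G.IsLatentWalk n p) (hq : G.IsLatentWalk n q)
    (hend : p n = q n) : p 0 = q 0 := by
  induction n with
  | zero => exact hend
  | succ n ih =>
    refine ih (fun t ht => hp t (by omega)) (fun t ht => hq t (by omega)) ?_
    exact hpar _ _ _ (hp n (by omega)) (hend ▸ hq n (by omega))

end LatentDigraph

/-- **Theorem 2.** A latent digraph satisfying Assumption A has the minimum
number of latent nodes among all latent digraphs on the same observed node set consistent
with the same linear measurements. -/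
theorem assumptionA_min_latent_card {O : Type} [Fintype O]
    (G G' : LatentDigraph O) [Fintype G.H] [Fintype G'.H]
    (hA : G.AssumptionA) (hcons : G.SameMeasurements G') :
    Fintype.card G.H ≤ Fintype.card G'.H := by
  obtain ⟨hpar, hacyc, hobs, hleaf⟩ := hA
  choose i hi hiu using hobs
  choose d p hp0 hp hmax using G.exists_longest_isLatentWalk hacyc
  have hend (h : G.H) : G.IsLatentLeaf (p h (d h)) :=
    (hp h).isLatentLeaf fun n q hq => hmax h n q (hq.trans (hp0 h))
  choose j hj hju using fun h => hleaf _ (hend h)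
  have hpath (h : G.H) : G'.LatentPath (d h + 2) (i h) (j h) :=
    (hcons _ (by omega) _ _).1 <| (hp h).latentPath (by rw [hp0]; exact hi h) (hj h)
  choose p' hp' hip' hjp' using fun h => (hpath h).exists_isLatentWalk
  have key (g h : G.H) (hle : d g ≤ d h) (heq : p' g 0 = p' h 0) : g = h := by
    have hswap : G.LatentPath (d h + 2) (i g) (j h) :=
      (hcons _ (by omega) _ _).2 <| (hp' h).latentPath (heq ▸ hip' g) (hjp' h)
    obtain ⟨q, hq, hiq, hjq⟩ := hswap.exists_isLatentWalk
    have hq0 : q 0 = g := by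
      by_contra hne
      exact hiu g _ hne hiq
    have hd : d h = d g := le_antisymm (hmax g _ q hq0 hq) hle
    have hql : G.IsLatentLeaf (q (d h)) :=
      hq.isLatentLeaf fun n q' hq' hw => hd ▸ hmax g n q' (hq'.trans hq0) hw
    have hqe : q (d h) = p h (d h) := by
      by_contra hne
      exact hju h _ hql hne hjq
    rw [← hq0, ← hp0 h]
    exact hq.start_eq hpar (hp h) hqe
  refine Fintype.card_le_of_injective (fun h => p' h 0) fun g h heq => ?_
  rcases le_total (d g) (d h) with hle | hle
  · exact key g h hle heq
  · exact (key h g hle heq.symm).symm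
end

section
/- Let G be a latent digraph satisfying Assumption A. Suppose j is the unique observed parent of a latent node h (i.e., j → h is an edge and j is not a parent of any other latent node), and let i be any observed node that is a parent of h. Then M_j ⊆ M_i, i.e., for every observed node u and every r, if there is a directed latent path of length r from j to u, then there is a directed latent path of length r from i to u. -/
namespace LatentDigraph

variable {O : Type}

/-- `lmax G i` is the maximum length of a directed latent path starting at the observed
node `i` (the quantity `l_i` of the paper). -/
noncomputable def lmax (G : LatentDigraph O) (i : O) : ℕ :=
  sSup {k | ∃ j : O, G.LatentPath k i j}

/-- `Rset G i` is the set of observed nodes reachable from `i` by a directed latent path of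
the maximum length `lmax G i` (the set `R_i` of the paper). -/
noncomputable def Rset (G : LatentDigraph O) (i : O) : Set O :=
  {j | G.LatentPath (G.lmax i) i j}

/-- `Mset G i` is the set of pairs `(j, r)` such that there is a directed latent path of
length `r` from `i` to `j` (the set `M_i` of the paper; latent paths have length `r ≥ 2`). -/
def Mset (G : LatentDigraph O) (i : O) : Set (O × ℕ) :=
  {p | 2 ≤ p.2 ∧ G.LatentPath p.2 i p.1}

end LatentDigraph

/-- In a latent digraph satisfying Assumption A, if `j` is the unique
observed parent of a latent node `h` and `i` is any observed parent of `h`, then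
`M_j ⊆ M_i`: every directed latent path length from `j` to an observed node `u` is also
realized by a directed latent path from `i` to `u`. -/
theorem unique_parent_Mset_subset {O : Type} [Fintype O]
    (G : LatentDigraph O) [Fintype G.H] (hA : G.AssumptionA)
    (j i : O) (h : G.H)
    (hj : G.edge (Sum.inl j) (Sum.inr h))
    (huniq : ∀ h' : G.H, h' ≠ h → ¬ G.edge (Sum.inl j) (Sum.inr h'))
    (hi : G.edge (Sum.inl i) (Sum.inr h)) :
    G.Mset j ⊆ G.Mset i := by
  rintro ⟨u, r⟩ ⟨hr, p, hp0, hpr, hlat, hedge⟩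
  dsimp only at hr hpr hlat hedge
  have hp1 : p 1 = Sum.inr h := by
    obtain ⟨h', hh'⟩ := hlat 1 one_pos (by omega)
    have he := hedge 0 (by omega)
    rw [hp0, zero_add, hh'] at he
    rw [hh', not_not.mp fun hne => huniq h' hne he]
  refine ⟨hr, fun t => if t = 0 then Sum.inl i else p t, if_pos rfl, ?_, ?_, ?_⟩
  · simpa [show r ≠ 0 by omega] using hpr
  · intro t ht htr
    simpa [ht.ne'] using hlat t ht htr
  · intro t htr
    rcases Nat.eq_zero_or_pos t with rfl | ht
    · simpa [hp1] using hi
    · simpa [ht.ne'] using hedge t htr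
end

section
/- Let C_1, …, C_p be subsets of a finite set U = {1, …, n} and let k be a natural number. The following are equivalent: (a) there exist subsets B_1, …, B_k of U such that for every i there is an index set S_i ⊆ {1, …, k} with C_i = ⋃_{s ∈ S_i} B_s; (b) there exist a p×k matrix A and a k×n matrix B, both with entries in {0, 1} (viewed as natural numbers), such that for all i ∈ {1, …, p} and j ∈ {1, …, n}, the (i,j) entry of the matrix product A·B is nonzero if and only if j ∈ C_i. -/
/-- An entry of a product of natural-number matrices is nonzero iff some summand has both
factors nonzero. -/
theorem Matrix.mul_apply_ne_zero_iff_of_nat {l m n : Type*} [Fintype m]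
    (A : Matrix l m ℕ) (B : Matrix m n ℕ) (i : l) (j : n) :
    (A * B) i j ≠ 0 ↔ ∃ s, A i s ≠ 0 ∧ B s j ≠ 0 := by
  simp [Matrix.mul_apply, Finset.sum_eq_zero_iff]

/-- The set basis problem is equivalent to the 0–1 matrix factorization of
the prescribed support: subsets `C_1, …, C_p` of `{1, …, n}` are unions of subfamilies of
some `k` sets `B_1, …, B_k` iff there are 0–1 matrices `A : p × k` and `B : k × n` (over ℕ)
with `(A·B)_{ij} ≠ 0 ↔ j ∈ C_i`. -/
theorem set_basis_iff_matrix_factorization {p n : ℕ} (C : Fin p → Set (Fin n)) (k : ℕ) :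
    (∃ B : Fin k → Set (Fin n), ∀ i : Fin p, ∃ S : Set (Fin k), C i = ⋃ s ∈ S, B s) ↔
    (∃ (A : Matrix (Fin p) (Fin k) ℕ) (B : Matrix (Fin k) (Fin n) ℕ),
      (∀ i j, A i j = 0 ∨ A i j = 1) ∧ (∀ i j, B i j = 0 ∨ B i j = 1) ∧
      ∀ (i : Fin p) (j : Fin n), (A * B) i j ≠ 0 ↔ j ∈ C i) := by
  classical
  constructor
  · rintro ⟨B, hB⟩
    choose S hS using hB
    refine ⟨Matrix.of fun i s => if s ∈ S i then 1 else 0,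
      Matrix.of fun s j => if j ∈ B s then 1 else 0, fun i s => ?_, fun s j => ?_, fun i j => ?_⟩
    · by_cases h : s ∈ S i <;> simp [h]
    · by_cases h : j ∈ B s <;> simp [h]
    · rw [Matrix.mul_apply_ne_zero_iff_of_nat, hS i]
      simp
  · rintro ⟨A, B, -, -, h⟩
    refine ⟨fun s => {j | B s j ≠ 0}, fun i => ⟨{s | A i s ≠ 0}, ?_⟩⟩
    ext j
    rw [← h, Matrix.mul_apply_ne_zero_iff_of_nat]
    simp
end

section
/- (Core of Theorem 5.) For distinct latent nodes a, b of a latent digraph G, define Merge(G, a, b) as the latent digraph obtained from G by deleting b (and all edges incident to b, including any edges between a and b) and adding an edge u → a for every parent u ≠ a of b and an edge a → v for every child v ≠ a of b. Let L be a family of linear measurements, and let G_min be a latent digraph consistent with L that has the minimum number of latent nodes among all latent digraphs consistent with L, and in which between any two observed nodes there is at most one directed latent path of each length. Then there is a finite sequence of latent digraphs G⁰, G¹, …, G^T such that G⁰ is the initialization graph G₀ built from L (a disjoint chain of k−1 fresh latent nodes for each (i,j,k) ∈ L), G^T is isomorphic to G_min via an isomorphism fixing all observed nodes, each G^{t+1}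 is Merge(G^t, a, b) for some pair of latent nodes a, b of G^t, and every G^t is consistent with L. -/
namespace LatentDigraph

variable {O : Type}

/-- The latent nodes `(i, j, k, r)` of the initialization graph `G₀` built from a finite
family `L` of required latent-path lengths: one chain node for each `(i, j, k) ∈ L` and each
`1 ≤ r ≤ k - 1`. -/
def InitLatent (L : Finset (O × O × ℕ)) : Type :=
  {x : (O × O × ℕ) × ℕ // x.1 ∈ L ∧ 1 ≤ x.2 ∧ x.2 ≤ x.1.2.2 - 1}

/-- The initialization graph `G₀` of the NM algorithm: for each `(i, j, k) ∈ L` it contains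
a disjoint chain `i → (i,j,k,1) → (i,j,k,2) → ⋯ → (i,j,k,k-1) → j` of `k - 1` fresh latent
nodes. -/
def InitGraph (L : Finset (O × O × ℕ)) : LatentDigraph O where
  H := InitLatent L
  edge u v :=
    match u, v with
    | Sum.inl i, Sum.inr x => i = x.val.1.1 ∧ x.val.2 = 1
    | Sum.inr x, Sum.inr y => x.val.1 = y.val.1 ∧ y.val.2 = x.val.2 + 1
    | Sum.inr x, Sum.inl j => j = x.val.1.2.1 ∧ x.val.2 = x.val.1.2.2 - 1
    | Sum.inl _, Sum.inl _ => False
  no_oo := fun _ _ h => h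

end LatentDigraph

namespace LatentDigraph

variable {O : Type}

/-- A latent digraph is consistent with the finite family `L` of linear measurements if for
every `k ≥ 2` it has a directed latent path of length `k` from `i` to `j` exactly when
`(i, j, k) ∈ L`. -/
def Consistent (G : LatentDigraph O) (L : Finset (O × O × ℕ)) : Prop :=
  ∀ (i j : O) (k : ℕ), 2 ≤ k → (G.LatentPath k i j ↔ (i, j, k) ∈ L)

/-- Between any two observed nodes there is at most one directed latent path of each
length (Assumption 2 of the paper). -/
def AtMostOnePath (G : LatentDigraph O) : Prop :=
  ∀ (k : ℕ) (i j : O) (p q : ℕ → O ⊕ G.H),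
    G.IsLatentPath k i j p → G.IsLatentPath k i j q → ∀ t ≤ k, p t = q t

/-- `Merge G a b`: delete the latent node `b` (and all edges incident to it, including any
edges between `a` and `b`), and give all the remaining parents and children of `b` to `a`. -/
def Merge (G : LatentDigraph O) (a b : G.H) (hab : a ≠ b) : LatentDigraph O where
  H := {h : G.H // h ≠ b}
  edge u v :=
    G.edge (Sum.map id Subtype.val u) (Sum.map id Subtype.val v) ∨
      (v = Sum.inr ⟨a, hab⟩ ∧ G.edge (Sum.map id Subtype.val u) (Sum.inr b) ∧
        Sum.map id Subtype.val u ≠ Sum.inr a) ∨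
      (u = Sum.inr ⟨a, hab⟩ ∧ G.edge (Sum.inr b) (Sum.map id Subtype.val v) ∧
        Sum.map id Subtype.val v ≠ Sum.inr a)
  no_oo := by
    intro i j h
    rcases h with h | ⟨h, -, -⟩ | ⟨h, -, -⟩
    · exact G.no_oo i j h
    · simp at h
    · simp at h

end LatentDigraph

namespace LatentDigraph

variable {O : Type}

/-- A latent digraph homomorphism that fixes the observed nodes. -/
def IsHom (G G' : LatentDigraph O) (f : G.H → G'.H) : Prop :=
  ∀ u v, G.edge u v → G'.edge (Sum.map id f u) (Sum.map id f v)

theorem IsLatentPath.map {G G' : LatentDigraph O} {f : G.H → G'.H} (hf : G.IsHom G' f)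
    {k : ℕ} {i j : O} {p : ℕ → O ⊕ G.H} (hp : G.IsLatentPath k i j p) :
    G'.IsLatentPath k i j (fun t => Sum.map id f (p t)) := by
  obtain ⟨h0, hk, hlat, hedge⟩ := hp
  refine ⟨by simp [h0], by simp [hk], fun t ht htk => ?_, fun t ht => hf _ _ (hedge t ht)⟩
  obtain ⟨h, hh⟩ := hlat t ht htk
  exact ⟨f h, by simp [hh]⟩

theorem LatentPath.map {G G' : LatentDigraph O} {f : G.H → G'.H} (hf : G.IsHom G' f)
    {k : ℕ} {i j : O} (h : G.LatentPath k i j) : G'.LatentPath k i j :=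
  let ⟨_, hp⟩ := h
  ⟨_, hp.map hf⟩

/-- `q` is a walk with `r` edges from the observed node `i` to `u` all of whose nodes other than
the first are latent. -/
def IsPathTo (G : LatentDigraph O) (r : ℕ) (i : O) (u : O ⊕ G.H) (q : ℕ → O ⊕ G.H) : Prop :=
  q 0 = Sum.inl i ∧ q r = u ∧ (∀ t, 0 < t → t ≤ r → ∃ h : G.H, q t = Sum.inr h) ∧
    (∀ t, t < r → G.edge (q t) (q (t + 1)))

/-- `q` is a walk with `s` edges from `v` to the observed node `j` all of whose nodes other than
the last are latent. -/
def IsPathFrom (G : LatentDigraph O) (s : ℕ) (v : O ⊕ G.H) (j : O) (q : ℕ → O ⊕ G.H) : Prop :=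
  q 0 = v ∧ q s = Sum.inl j ∧ (∀ t, t < s → ∃ h : G.H, q t = Sum.inr h) ∧
    (∀ t, t < s → G.edge (q t) (q (t + 1)))

theorem IsPathTo.append {G : LatentDigraph O} {r s : ℕ} {i j : O} {u v : O ⊕ G.H}
    {q q' : ℕ → O ⊕ G.H} (hq : G.IsPathTo r i u q) (hq' : G.IsPathFrom s v j q')
    (huv : G.edge u v) :
    G.IsLatentPath (r + 1 + s) i j (fun t => if t ≤ r then q t else q' (t - (r + 1))) := by
  obtain ⟨h0, hr, hlat, hedge⟩ := hq
  obtain ⟨h0', hs, hlat', hedge'⟩ := hq'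
  refine ⟨by simp [h0], ?_, fun t ht htk => ?_, fun t ht => ?_⟩
  · have h1 : ¬ r + 1 + s ≤ r := by omega
    have h2 : r + 1 + s - (r + 1) = s := by omega
    simp only [h1, if_false, h2, hs]
  · by_cases h : t ≤ r
    · simpa only [h, if_true] using hlat t ht h
    · simpa only [h, if_false] using hlat' (t - (r + 1)) (by omega)
  · rcases lt_trichotomy t r with h | h | h
    · have h1 : t ≤ r := by omega
      have h2 : t + 1 ≤ r := by omega
      simpa only [h1, h2, if_true] using hedge t h
    · subst h
      simpa [hr, h0'] using huv
    · have h1 : ¬ t ≤ r := by omega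
      have h2 : ¬ t + 1 ≤ r := by omega
      have h3 : t + 1 - (r + 1) = t - (r + 1) + 1 := by omega
      simpa only [h1, h2, if_false, h3] using hedge' (t - (r + 1)) (by omega)

theorem IsPathTo.snoc {G : LatentDigraph O} {r : ℕ} {i : O} {u : O ⊕ G.H} {h : G.H}
    {q : ℕ → O ⊕ G.H} (hq : G.IsPathTo r i u q) (huh : G.edge u (Sum.inr h)) :
    G.IsPathTo (r + 1) i (Sum.inr h) (fun t => if t ≤ r then q t else Sum.inr h) := by
  obtain ⟨h0, hr, hlat, hedge⟩ := hq
  refine ⟨by simp [h0], by simp, fun t ht htk => ?_, fun t ht => ?_⟩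
  · by_cases h : t ≤ r
    · simpa only [h, if_true] using hlat t ht h
    · simp [h]
  · rcases (Nat.lt_succ_iff.mp ht).lt_or_eq with h | h
    · have h1 : t ≤ r := by omega
      have h2 : t + 1 ≤ r := by omega
      simpa only [h1, h2, if_true] using hedge t h
    · subst h
      simpa [hr] using huh

theorem IsLatentPath.isPathTo {G : LatentDigraph O} {k : ℕ} {i j : O} {p : ℕ → O ⊕ G.H}
    (hp : G.IsLatentPath k i j p) {r : ℕ} (hr : r < k) : G.IsPathTo r i (p r) p :=
  ⟨hp.1, rfl, fun t ht htr => hp.2.2.1 t ht (by omega), fun t ht => hp.2.2.2 t (by omega)⟩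

theorem IsLatentPath.isPathFrom {G : LatentDigraph O} {k : ℕ} {i j : O} {p : ℕ → O ⊕ G.H}
    (hp : G.IsLatentPath k i j p) {r : ℕ} (hr0 : 0 < r) (hr : r < k) :
    G.IsPathFrom (k - r) (p r) j (fun t => p (r + t)) := by
  refine ⟨rfl, ?_, fun t ht => hp.2.2.1 _ (by omega) (by omega),
    fun t ht => hp.2.2.2 (r + t) (by omega)⟩
  have h : r + (k - r) = k := by omega
  simpa only [h] using hp.2.1

/-- Every latent node lies on a latent path between observed nodes. -/
def Covered (G : LatentDigraph O) : Prop :=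
  ∀ h : G.H, ∃ (k : ℕ) (i j : O) (p : ℕ → O ⊕ G.H) (r : ℕ),
    G.IsLatentPath k i j p ∧ 0 < r ∧ r < k ∧ p r = Sum.inr h

theorem Covered.exists_isPathTo {G : LatentDigraph O} (hG : G.Covered) (u : O ⊕ G.H) :
    ∃ r i q, G.IsPathTo r i u q := by
  rcases u with i | h
  · exact ⟨0, i, fun _ => Sum.inl i, rfl, rfl, fun t _ _ => by omega, fun t _ => by omega⟩
  · obtain ⟨k, i, j, p, r, hp, -, hr, hpr⟩ := hG h
    exact ⟨r, i, p, hpr ▸ hp.isPathTo hr⟩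

theorem Covered.exists_isPathFrom {G : LatentDigraph O} (hG : G.Covered) (v : O ⊕ G.H) :
    ∃ s j q, G.IsPathFrom s v j q := by
  rcases v with j | h
  · exact ⟨0, j, fun _ => Sum.inl j, rfl, rfl, fun t _ => by omega, fun t _ => by omega⟩
  · obtain ⟨k, i, j, p, r, hp, hr0, hr, hpr⟩ := hG h
    exact ⟨k - r, j, _, hpr ▸ hp.isPathFrom hr0 hr⟩

/-- In a covered latent digraph every edge lies on a latent path between observed nodes. -/
theorem Covered.exists_isLatentPath_of_edge {G : LatentDigraph O} (hG : G.Covered)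
    {u v : O ⊕ G.H} (huv : G.edge u v) :
    ∃ (k : ℕ) (i j : O) (p : ℕ → O ⊕ G.H) (r : ℕ),
      2 ≤ k ∧ G.IsLatentPath k i j p ∧ r < k ∧ p r = u ∧ p (r + 1) = v := by
  obtain ⟨r, i, q, hq⟩ := hG.exists_isPathTo u
  obtain ⟨s, j, q', hq'⟩ := hG.exists_isPathFrom v
  refine ⟨r + 1 + s, i, j, _, r, ?_, hq.append hq' huv, by omega, ?_, ?_⟩
  · by_contra hlt
    obtain rfl : r = 0 := by omega
    obtain rfl : s = 0 := by omega
    have hu : u = Sum.inl i := hq.2.1.symm.trans hq.1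
    have hv : v = Sum.inl j := hq'.1.symm.trans hq'.2.1
    subst hu hv
    exact G.no_oo _ _ huv
  · simpa using hq.2.1
  · simpa using hq'.1

theorem Covered.not_edge_self {G : LatentDigraph O} (hG : G.Covered)
    {L : Finset (O × O × ℕ)} (hcons : G.Consistent L) (h : G.H) :
    ¬ G.edge (Sum.inr h) (Sum.inr h) := by
  intro hh
  obtain ⟨s, j, q', hq'⟩ := hG.exists_isPathFrom (Sum.inr h)
  obtain ⟨r, i, q, hq⟩ := hG.exists_isPathTo (Sum.inr h)
  have key : ∀ m, ∃ q, G.IsPathTo (r + m) i (Sum.inr h) q := by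
    intro m
    induction m with
    | zero => exact ⟨q, hq⟩
    | succ m ih =>
      obtain ⟨q, hq⟩ := ih
      exact ⟨_, hq.snoc hh⟩
  obtain ⟨q, hq⟩ := key (L.sup (fun x => x.2.2) + 1)
  have hmem := (hcons i j _ (by omega)).1 ⟨_, hq.append hq' hh⟩
  have hle := Finset.le_sup (f := fun x : O × O × ℕ => x.2.2) hmem
  simp only at hle
  omega

/-- The induced subgraph obtained by deleting the latent node `b`. -/
def deleteLatent (G : LatentDigraph O) (b : G.H) : LatentDigraph O where
  H := {h : G.H // h ≠ b}
  edge u v := G.edge (Sum.map id Subtype.val u) (Sum.map id Subtype.val v)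
  no_oo i j h := G.no_oo i j h

theorem deleteLatent_isHom (G : LatentDigraph O) (b : G.H) :
    (G.deleteLatent b).IsHom G Subtype.val :=
  fun _ _ h => h

theorem IsLatentPath.latentPath_deleteLatent {G : LatentDigraph O} {k : ℕ} {i j : O}
    {p : ℕ → O ⊕ G.H} (hp : G.IsLatentPath k i j p) {b : G.H}
    (hb : ∀ t, 0 < t → t < k → p t ≠ Sum.inr b) : (G.deleteLatent b).LatentPath k i j := by
  have hlift : ∀ t, ∃ x : O ⊕ (G.deleteLatent b).H, t ≤ k → Sum.map id Subtype.val x = p t := by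
    intro t
    by_cases h0 : t = 0
    · exact ⟨Sum.inl i, fun _ => by rw [h0, hp.1]; rfl⟩
    by_cases hk : t = k
    · exact ⟨Sum.inl j, fun _ => by rw [hk, hp.2.1]; rfl⟩
    by_cases hlt : t < k
    · obtain ⟨h, hh⟩ := hp.2.2.1 t (by omega) hlt
      exact ⟨Sum.inr ⟨h, fun e => hb t (by omega) hlt (e ▸ hh)⟩, fun _ => hh.symm⟩
    · exact ⟨Sum.inl i, fun h => by omega⟩
  choose q hq using hlift
  have hinl : ∀ t ≤ k, ∀ i, p t = Sum.inl i → q t = Sum.inl i := by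
    intro t ht i hi
    have h := hq t ht
    rw [hi] at h
    rcases hx : q t with a | a <;> rw [hx] at h
    · exact congrArg Sum.inl (Sum.inl_injective h)
    · exact (Sum.inr_ne_inl h).elim
  refine ⟨q, hinl 0 (by omega) i hp.1, hinl k le_rfl j hp.2.1, fun t ht htk => ?_,
    fun t ht => ?_⟩
  · obtain ⟨h, hh⟩ := hp.2.2.1 t ht htk
    have h' := hq t htk.le
    rw [hh] at h'
    rcases hx : q t with a | a
    · rw [hx] at h'
      exact (Sum.inl_ne_inr h').elim
    · exact ⟨a, rfl⟩
  · change G.edge _ _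
    rw [hq t ht.le, hq (t + 1) ht]
    exact hp.2.2.2 t ht

/-- In a minimal consistent latent digraph, every latent node lies on one of any prescribed family
of latent paths realizing the measurements. -/
theorem Consistent.exists_mem_path_of_minimal {G : LatentDigraph O} [Fintype G.H]
    {L : Finset (O × O × ℕ)} (hcons : G.Consistent L)
    (hmin : ∀ (G' : LatentDigraph O) (_ : Fintype G'.H),
      G'.Consistent L → Fintype.card G.H ≤ Fintype.card G'.H)
    {P : O × O × ℕ → ℕ → O ⊕ G.H}
    (hP : ∀ x ∈ L, G.IsLatentPath x.2.2 x.1 x.2.1 (P x)) (h : G.H) :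
    ∃ x ∈ L, ∃ r, 0 < r ∧ r < x.2.2 ∧ P x r = Sum.inr h := by
  classical
  by_contra! hcon
  have hdel : (G.deleteLatent h).Consistent L := by
    refine fun i j k hk => ⟨fun hp => (hcons i j k hk).1 (hp.map (G.deleteLatent_isHom h)),
      fun hmem => ?_⟩
    exact (hP _ hmem).latentPath_deleteLatent fun t ht htk => hcon _ hmem t ht htk
  have hle := hmin (G.deleteLatent h) (Subtype.fintype fun x => x ≠ h) hdel
  have hlt : Fintype.card {x : G.H // x ≠ h} < Fintype.card G.H :=
    Fintype.card_subtype_lt (x := h) (by simp)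
  exact absurd (hle.trans_lt hlt) (lt_irrefl _)

/-- The canonical latent path of the initialization graph realizing `x`. -/
def initPath (L : Finset (O × O × ℕ)) (x : O × O × ℕ) (hx : x ∈ L) (t : ℕ) :
    O ⊕ (InitGraph L).H :=
  if h0 : t = 0 then Sum.inl x.1
  else if hk : t < x.2.2 then
    Sum.inr ⟨(x, t), hx, Nat.one_le_iff_ne_zero.2 h0, Nat.le_sub_one_of_lt hk⟩
  else Sum.inl x.2.1

theorem initPath_isLatentPath (L : Finset (O × O × ℕ)) (x : O × O × ℕ) (hx : x ∈ L)
    (hx2 : 2 ≤ x.2.2) : (InitGraph L).IsLatentPath x.2.2 x.1 x.2.1 (initPath L x hx) := by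
  refine ⟨by simp [initPath], ?_, fun t ht htk => ?_, fun t ht => ?_⟩
  · have h : x.2.2 ≠ 0 := by omega
    simp [initPath, h]
  · refine ⟨⟨(x, t), hx, ht, Nat.le_sub_one_of_lt htk⟩, ?_⟩
    simp only [initPath, ht.ne', htk, dif_pos, dif_neg, not_false_eq_true]
  · by_cases h0 : t = 0
    · subst h0
      have h : 1 < x.2.2 := by omega
      simp [initPath, InitGraph, h]
    · by_cases h : t + 1 < x.2.2
      · simp [initPath, InitGraph, h, h0, ht]
      · have h' : t = x.2.2 - 1 := by omega
        simp only [initPath, InitGraph, h, h0, ht, dif_pos, dif_neg, not_false_eq_true,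
          Nat.add_eq_zero_iff, one_ne_zero, and_false]
        exact ⟨trivial, h'⟩

theorem finite_initLatent (L : Finset (O × O × ℕ)) : Finite (InitLatent L) := by
  let F : InitLatent L → L × Fin (L.sup (fun x => x.2.2) + 1) := fun x =>
    (⟨x.1.1, x.2.1⟩, ⟨x.1.2, by
      have h1 := x.2.2.2
      have h2 := Finset.le_sup (f := fun x : O × O × ℕ => x.2.2) x.2.1
      change x.1.1.2.2 ≤ _ at h2
      omega⟩)
  refine Finite.of_injective F fun x y hxy => ?_
  have h1 : x.1.1 = y.1.1 := congrArg (fun z => z.1.1) hxy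
  have h2 : x.1.2 = y.1.2 := congrArg (fun z => z.2.1) hxy
  exact Subtype.ext (Prod.ext h1 h2)

open scoped Classical in
/-- The map on latent nodes that identifies `b` with `a`. -/
noncomputable def mergeMap (G : LatentDigraph O) (a b : G.H) (hab : a ≠ b) (h : G.H) :
    {h : G.H // h ≠ b} :=
  if hb : h = b then ⟨a, hab⟩ else ⟨h, hb⟩

theorem mergeMap_self (G : LatentDigraph O) (a b : G.H) (hab : a ≠ b) :
    G.mergeMap a b hab b = ⟨a, hab⟩ := by
  simp [mergeMap]

theorem mergeMap_of_ne (G : LatentDigraph O) (a b : G.H) (hab : a ≠ b) {h : G.H} (hb : h ≠ b) :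
    G.mergeMap a b hab h = ⟨h, hb⟩ := by
  simp [mergeMap, hb]

theorem map_val_map_mergeMap_of_ne (G : LatentDigraph O) (a b : G.H) (hab : a ≠ b) {u : O ⊕ G.H}
    (hu : u ≠ Sum.inr b) : Sum.map id Subtype.val (Sum.map id (G.mergeMap a b hab) u) = u := by
  rcases u with i | h
  · rfl
  · have hb : h ≠ b := fun e => hu (e ▸ rfl)
    simp [mergeMap_of_ne G a b hab hb]

/-- The merging map is a homomorphism when no edge joins the two merged nodes. -/
theorem isHom_mergeMap {G : LatentDigraph O} {a b : G.H} (hab : a ≠ b)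
    (h1 : ¬ G.edge (Sum.inr a) (Sum.inr b)) (h2 : ¬ G.edge (Sum.inr b) (Sum.inr a))
    (h3 : ¬ G.edge (Sum.inr b) (Sum.inr b)) :
    G.IsHom (G.Merge a b hab) (G.mergeMap a b hab) := by
  intro u v huv
  by_cases hu : u = Sum.inr b
  · subst hu
    have hv : v ≠ Sum.inr b := fun e => h3 (e ▸ huv)
    have hv' := map_val_map_mergeMap_of_ne G a b hab hv
    exact Or.inr (Or.inr ⟨congrArg Sum.inr (mergeMap_self G a b hab),
      (congrArg (G.edge (Sum.inr b)) hv').mpr huv, fun e => h2 (hv'.symm.trans e ▸ huv)⟩)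
  · have hu' := map_val_map_mergeMap_of_ne G a b hab hu
    by_cases hv : v = Sum.inr b
    · subst hv
      exact Or.inr (Or.inl ⟨congrArg Sum.inr (mergeMap_self G a b hab),
        (congrArg (G.edge · (Sum.inr b)) hu').mpr huv, fun e => h1 (hu'.symm.trans e ▸ huv)⟩)
    · exact Or.inl ((congrArg₂ G.edge hu' (map_val_map_mergeMap_of_ne G a b hab hv)).mpr huv)

theorem IsHom.merge {G G' : LatentDigraph O} {f : G.H → G'.H} (hf : G.IsHom G' f)
    {a b : G.H} (hab : a ≠ b) (hfab : f a = f b) :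
    (G.Merge a b hab).IsHom G' (fun h => f h.1) := by
  have hcomp : ∀ u : O ⊕ (G.Merge a b hab).H,
      Sum.map id (fun h : (G.Merge a b hab).H => f h.1) u
        = Sum.map id f (Sum.map id Subtype.val u) := by
    rintro (i | h) <;> rfl
  rintro u v (h | ⟨rfl, h, -⟩ | ⟨rfl, h, -⟩)
  · simpa only [hcomp] using hf _ _ h
  · have := hf _ _ h
    rw [hcomp]
    rw [Sum.map_inr, ← hfab] at this
    exact this
  · have := hf _ _ h
    rw [hcomp v]
    rw [Sum.map_inr, ← hfab] at this
    exact this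

/-- A consistent finite latent digraph with a homomorphism onto a loopless consistent latent
digraph (surjective on latent nodes and on edges) can be turned into the latter by
consistency-preserving merges. -/
theorem exists_merge_sequence {L : Finset (O × O × ℕ)} {G' : LatentDigraph O}
    (hcons : G'.Consistent L) (hloop : ∀ h : G'.H, ¬ G'.edge (Sum.inr h) (Sum.inr h))
    (G : LatentDigraph O) (hfin : Finite G.H) (hG : G.Consistent L) (f : G.H → G'.H)
    (hf : G.IsHom G' f) (hsurj : Function.Surjective f)
    (hedge : ∀ u v, G'.edge u v →
      ∃ u' v', G.edge u' v' ∧ Sum.map id f u' = u ∧ Sum.map id f v' = v) :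
    ∃ (T : ℕ) (Gs : ℕ → LatentDigraph O),
      Gs 0 = G ∧
      (∀ t < T, ∃ (a b : (Gs t).H) (hab : a ≠ b), Gs (t + 1) = (Gs t).Merge a b hab) ∧
      (∀ t ≤ T, (Gs t).Consistent L) ∧
      ∃ φ : (Gs T).H ≃ G'.H,
        ∀ u v : O ⊕ (Gs T).H,
          (Gs T).edge u v ↔ G'.edge (Sum.map id φ u) (Sum.map id φ v) := by
  induction hn : Nat.card G.H using Nat.strong_induction_on generalizing G with
  | _ n ih =>
  by_cases hinj : Function.Injective f
  · refine ⟨0, fun _ => G, rfl, fun t ht => by omega, fun _ _ => hG,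
      Equiv.ofBijective f ⟨hinj, hsurj⟩, fun u v => ⟨hf u v, fun h => ?_⟩⟩
    obtain ⟨u', v', huv, hu, hv⟩ := hedge _ _ h
    have hinj' : Function.Injective (Sum.map (id : O → O) f) :=
      Function.injective_id.sumMap hinj
    rwa [hinj' hu, hinj' hv] at huv
  · obtain ⟨a, b, hfab, hab⟩ := Function.not_injective_iff.1 hinj
    have hne : ∀ x y, f x = f y → ¬ G.edge (Sum.inr x) (Sum.inr y) := by
      intro x y hxy h
      refine hloop (f x) ?_
      have := hf _ _ h
      simpa [← hxy] using this
    have hm : G.IsHom (G.Merge a b hab) (G.mergeMap a b hab) :=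
      isHom_mergeMap hab (hne _ _ hfab) (hne _ _ hfab.symm) (hne _ _ rfl)
    have hfm : ∀ h, f (G.mergeMap a b hab h).1 = f h := by
      intro h
      by_cases hb : h = b
      · subst hb
        rw [mergeMap_self, hfab]
      · rw [mergeMap_of_ne G a b hab hb]
    have hf' := hf.merge hab hfab
    have hfm' : ∀ u : O ⊕ G.H, Sum.map id (fun h : (G.Merge a b hab).H => f h.1)
        (Sum.map id (G.mergeMap a b hab) u) = Sum.map id f u := by
      rintro (i | h)
      · rfl
      · exact congrArg Sum.inr (hfm h)
    obtain ⟨T, Gs, h0, hstep, hGs, hφ⟩ := ih (Nat.card (G.Merge a b hab).H)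
      (hn ▸ Finite.card_subtype_lt (p := fun h => h ≠ b) (x := b) (by simp)) (G.Merge a b hab)
      (inferInstanceAs (Finite {h : G.H // h ≠ b}))
      (fun i j k hk => ⟨fun hp => (hcons i j k hk).1 (hp.map hf'),
        fun hmem => ((hG i j k hk).2 hmem).map hm⟩)
      (fun h => f h.1) hf'
      (fun y => by
        obtain ⟨x, rfl⟩ := hsurj y
        exact ⟨_, hfm x⟩)
      (fun u v huv => by
        obtain ⟨u', v', h, rfl, rfl⟩ := hedge u v huv
        exact ⟨_, _, hm _ _ h, hfm' u', hfm' v'⟩)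
      rfl
    refine ⟨T + 1, fun t => Nat.casesOn t G Gs, rfl, ?_, ?_, hφ⟩
    · rintro (_ | t) ht
      · exact ⟨a, b, hab, h0⟩
      · exact hstep t (by omega)
    · rintro (_ | t) ht
      · exact hG
      · exact hGs t (by omega)

end LatentDigraph

/-- **core of Theorem 5.** If `G_min` is consistent with the finite family
`L` of linear measurements, has the minimum number of latent nodes among all latent digraphs
consistent with `L`, and has at most one directed latent path of each length between any two
observed nodes, then `G_min` is reachable (up to an isomorphism fixing the observed nodes)
from the initialization graph `G₀` by a finite sequence of merges of pairs of latent nodes,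
all of whose intermediate graphs are consistent with `L`. -/
theorem nm_reaches_minimal {O : Type} [Fintype O] (L : Finset (O × O × ℕ))
    (hL : ∀ x ∈ L, 2 ≤ x.2.2)
    (Gmin : LatentDigraph O) [Fintype Gmin.H]
    (hcons : Gmin.Consistent L)
    (hmin : ∀ (G' : LatentDigraph O) (_ : Fintype G'.H),
      G'.Consistent L → Fintype.card Gmin.H ≤ Fintype.card G'.H)
    (hone : Gmin.AtMostOnePath) :
    ∃ (T : ℕ) (Gs : ℕ → LatentDigraph O),
      Gs 0 = LatentDigraph.InitGraph L ∧
      (∀ t < T, ∃ (a b : (Gs t).H) (hab : a ≠ b), Gs (t + 1) = (Gs t).Merge a b hab) ∧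
      (∀ t ≤ T, (Gs t).Consistent L) ∧
      ∃ φ : (Gs T).H ≃ Gmin.H,
        ∀ u v : O ⊕ (Gs T).H,
          (Gs T).edge u v ↔ Gmin.edge (Sum.map id φ u) (Sum.map id φ v) := by
  obtain ⟨P, hP⟩ : ∃ P : O × O × ℕ → ℕ → O ⊕ Gmin.H,
      ∀ x ∈ L, Gmin.IsLatentPath x.2.2 x.1 x.2.1 (P x) := by
    have h : ∀ x : O × O × ℕ, ∃ p, x ∈ L → Gmin.IsLatentPath x.2.2 x.1 x.2.1 p := fun x => by
      by_cases hx : x ∈ L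
      · exact ((hcons x.1 x.2.1 x.2.2 (hL x hx)).2 hx).imp fun _ hp _ => hp
      · exact ⟨fun _ => Sum.inl x.1, fun h => absurd h hx⟩
    choose P hP using h
    exact ⟨P, hP⟩
  have hlat : ∀ x : LatentDigraph.InitLatent L, ∃ h, P x.1.1 x.1.2 = Sum.inr h := fun x =>
    (hP _ x.2.1).2.2.1 x.1.2 x.2.2.1 (by have := x.2.2.1; have := x.2.2.2; omega)
  choose f hf using hlat
  have hmap : ∀ x (hx : x ∈ L) t, t ≤ x.2.2 → Sum.map id f (LatentDigraph.initPath L x hx t) = P x t := by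
    intro x hx t ht
    unfold LatentDigraph.initPath
    split_ifs with h0 hk
    · subst h0
      exact (hP x hx).1.symm
    · exact (hf ⟨(x, t), hx, Nat.one_le_iff_ne_zero.2 h0, Nat.le_sub_one_of_lt hk⟩).symm
    · obtain rfl : t = x.2.2 := by omega
      exact (hP x hx).2.1.symm
  have hcov : Gmin.Covered := fun h => by
    obtain ⟨x, hx, r, hr0, hr, hxr⟩ := hcons.exists_mem_path_of_minimal hmin hP h
    exact ⟨_, _, _, _, r, hP x hx, hr0, hr, hxr⟩
  have hhom : (LatentDigraph.InitGraph L).IsHom Gmin f := by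
    have hedge : ∀ x ∈ L, ∀ r s u v, s = r + 1 → r < x.2.2 → P x r = u → P x s = v →
        Gmin.edge u v := by
      rintro x hx r _ _ _ rfl hr rfl rfl
      exact (hP x hx).2.2.2 r hr
    rintro (i | (x : LatentDigraph.InitLatent L)) (j | (y : LatentDigraph.InitLatent L)) h
    · exact h.elim
    · obtain ⟨rfl, h1⟩ := h
      exact hedge _ y.2.1 0 y.1.2 _ _ h1 (by have := hL _ y.2.1; omega) (hP _ y.2.1).1 (hf y)
    · obtain ⟨rfl, h1⟩ := h
      have h2 := hL _ x.2.1
      exact hedge _ x.2.1 x.1.2 x.1.1.2.2 _ _ (by omega) (by omega) (hf x) (hP _ x.2.1).2.1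
    · obtain ⟨h1, h2⟩ := h
      exact hedge _ x.2.1 x.1.2 y.1.2 _ _ h2
        (by have := x.2.2.1; have := x.2.2.2; omega) (hf x)
        ((congrArg (P · y.1.2) h1).trans (hf y))
  refine LatentDigraph.exists_merge_sequence hcons (hcov.not_edge_self hcons) (LatentDigraph.InitGraph L)
    (LatentDigraph.finite_initLatent L) (fun i j k hk => ⟨fun hp => (hcons i j k hk).1 (hp.map hhom),
      fun hmem => ⟨_, LatentDigraph.initPath_isLatentPath L _ hmem hk⟩⟩) f hhom ?_ ?_
  · intro h
    obtain ⟨x, hx, r, hr0, hr, hxr⟩ := hcons.exists_mem_path_of_minimal hmin hP h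
    exact ⟨⟨(x, r), hx, hr0, Nat.le_sub_one_of_lt hr⟩, Sum.inr_injective ((hf _).symm.trans hxr)⟩
  · intro u v huv
    obtain ⟨k, i, j, p, r, hk, hp, hr, rfl, rfl⟩ := hcov.exists_isLatentPath_of_edge huv
    have hmem := (hcons i j k hk).1 ⟨p, hp⟩
    have heq := hone k i j _ _ (hP _ hmem) hp
    refine ⟨_, _, (LatentDigraph.initPath_isLatentPath L _ hmem hk).2.2.2 r hr, ?_, ?_⟩
    · exact (hmap _ hmem r hr.le).trans (heq r hr.le)
    · exact (hmap _ hmem (r + 1) hr).trans (heq (r + 1) hr)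
end
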